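/- arXiv:2411.19784 — 2 statements merged into one kernel-verified Lean document; each statement's English description precedes it below -/
import Mathlib

section
/- Let n = 2m+1 with m ≥ 1, let A be the adjacency matrix and D the distance matrix of the cycle graph C_n (viewed as complex n×n matrices), let s, t be real numbers, and for j ∈ {0,1,…,n−1} let v^{(j)} be the complex vector with k-th entry e^{2πijk/n} (k = 0,…,n−1). Then v^{(j)} is an eigenvector of sA + tD with eigenvalue: 2s + t(n²−1)/4 if j = 0; 2s·cos(2πj/n) − (t/4)·sec²(πj/(2n)) if j is even and j ≠ 0; and 2s·cos(2πj/n) − (t/4)·csc²(πj/(2n)) if j is odd. -/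
open SimpleGraph

/-- The word length of `x : Fin n` with respect to the generators `±1`. -/
def cyclicNorm {n : ℕ} (x : Fin n) : ℕ := min (x : ℕ) (n - x)

theorem cyclicNorm_add_le {n : ℕ} (x y : Fin n) :
    cyclicNorm (x + y) ≤ cyclicNorm x + cyclicNorm y := by
  have hx := x.isLt
  have hy := y.isLt
  unfold cyclicNorm
  rw [Fin.val_add_eq_ite]
  split_ifs <;> omega

theorem cyclicNorm_neg {n : ℕ} [NeZero n] (x : Fin n) : cyclicNorm (-x) = cyclicNorm x := by
  have hx := x.isLt
  unfold cyclicNorm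
  rw [Fin.val_neg]
  split_ifs with h
  · simp [h]
  · omega

theorem cyclicNorm_sub_le_length {n : ℕ} {u v : Fin (n + 1)} (p : (cycleGraph (n + 1)).Walk u v) :
    cyclicNorm (v - u) ≤ p.length := by
  induction p with
  | nil => simp [cyclicNorm]
  | @cons u w v h p ih =>
    have hstep : cyclicNorm (w - u) ≤ 1 := by
      rcases cycleGraph_adj'.1 h with h | h
      · rw [← neg_sub, cyclicNorm_neg]
        exact (min_le_left _ _).trans h.le
      · exact (min_le_left _ _).trans h.le
    have := cyclicNorm_add_le (v - w) (w - u)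
    rw [sub_add_sub_cancel] at this
    rw [Walk.length_cons]
    omega

theorem exists_walk_cycleGraph_add {n : ℕ} (u d : Fin (n + 2)) :
    ∃ p : (cycleGraph (n + 2)).Walk u (u + d), p.length = d := by
  induction d using Fin.induction with
  | zero => exact ⟨Walk.nil.copy rfl (by simp), by simp⟩
  | succ d ih =>
    obtain ⟨p, hp⟩ := ih
    have h : (cycleGraph (n + 2)).Adj (u + d.castSucc) (u + d.succ) := by
      rw [cycleGraph_adj, ← Fin.coeSucc_eq_succ]
      right
      abel
    exact ⟨p.concat h, by simp [hp]⟩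

theorem dist_cycleGraph_add_le {n : ℕ} (u d : Fin (n + 2)) :
    (cycleGraph (n + 2)).dist u (u + d) ≤ d := by
  obtain ⟨p, hp⟩ := exists_walk_cycleGraph_add u d
  exact hp ▸ dist_le p

theorem dist_cycleGraph_add {n : ℕ} (u d : Fin (n + 2)) :
    (cycleGraph (n + 2)).dist u (u + d) = cyclicNorm d := by
  apply le_antisymm
  · refine le_min (dist_cycleGraph_add_le u d) ?_
    have h := dist_cycleGraph_add_le (u + d) (-d)
    rw [add_neg_cancel_right, dist_comm, Fin.val_neg] at h
    split_ifs at h with h0 <;> omega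
  · obtain ⟨q, -⟩ := exists_walk_cycleGraph_add u d
    obtain ⟨p, hp⟩ := q.reachable.exists_walk_length_eq_dist
    have := cyclicNorm_sub_le_length p
    rwa [add_sub_cancel_left, hp] at this

theorem one_sub_sq_mul_sum_range_mul_pow {R : Type*} [CommRing R] (z : R) (k : ℕ) :
    (1 - z) ^ 2 * ∑ i ∈ Finset.range (k + 1), (i : R) * z ^ i =
      z - (k + 1) * z ^ (k + 1) + k * z ^ (k + 2) := by
  induction k with
  | zero => simp
  | succ k ih =>
    rw [Finset.sum_range_succ, mul_add, ih]
    push_cast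
    ring

theorem one_sub_sq_mul_sum_range_sub_mul_pow {R : Type*} [CommRing R] (z : R) (k : ℕ) :
    (1 - z) ^ 2 * ∑ i ∈ Finset.range k, ((k : R) - i) * z ^ i =
      k - (k + 1) * z + z ^ (k + 1) := by
  induction k with
  | zero => simp
  | succ k ih =>
    have h : ∑ i ∈ Finset.range k, (((k + 1 : ℕ) : R) - ((i + 1 : ℕ) : R)) * z ^ (i + 1) =
        z * ∑ i ∈ Finset.range k, ((k : R) - i) * z ^ i := by
      rw [Finset.mul_sum]
      refine Finset.sum_congr rfl fun i _ => ?_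
      push_cast
      ring
    rw [Finset.sum_range_succ', h, mul_add, mul_left_comm, ih]
    push_cast
    ring

theorem sum_cyclicNorm_mul_pow {R : Type*} [CommRing R] (m : ℕ) (z : R) :
    ∑ d : Fin (2 * m + 1), (cyclicNorm d : R) * z ^ (d : ℕ) =
      ∑ i ∈ Finset.range (m + 1), (i : R) * z ^ i +
        z ^ (m + 1) * ∑ i ∈ Finset.range m, ((m : R) - i) * z ^ i := by
  unfold cyclicNorm
  rw [← Finset.sum_range fun d => ((min d (2 * m + 1 - d) : ℕ) : R) * z ^ d,
    show 2 * m + 1 = m + 1 + m by ring, Finset.sum_range_add, Finset.mul_sum]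
  congr 1
  · refine Finset.sum_congr rfl fun i hi => ?_
    rw [Finset.mem_range] at hi
    rw [min_eq_left (by omega)]
  · refine Finset.sum_congr rfl fun i hi => ?_
    rw [Finset.mem_range] at hi
    rw [min_eq_right (by omega), show m + 1 + m - (m + 1 + i) = m - i by omega,
      Nat.cast_sub hi.le]
    ring

theorem one_sub_sq_mul_sum_cyclicNorm {R : Type*} [CommRing R] (m : ℕ) (z : R) :
    (1 - z) ^ 2 * ∑ d : Fin (2 * m + 1), (cyclicNorm d : R) * z ^ (d : ℕ) =
      z - z ^ (m + 1) - z ^ (m + 2) + z ^ (2 * m + 2) := by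
  rw [sum_cyclicNorm_mul_pow, mul_add, mul_left_comm, one_sub_sq_mul_sum_range_mul_pow,
    one_sub_sq_mul_sum_range_sub_mul_pow]
  ring

theorem sum_cyclicNorm (m : ℕ) :
    ∑ d : Fin (2 * m + 1), (cyclicNorm d : ℂ) = m * (m + 1) := by
  have h := sum_cyclicNorm_mul_pow m (1 : ℂ)
  simp only [one_pow, mul_one, one_mul] at h
  rw [h, Finset.sum_range_succ, add_right_comm, ← Finset.sum_add_distrib]
  simp only [add_sub_cancel, Finset.sum_const, Finset.card_range, nsmul_eq_mul]
  ring

theorem pow_val_add {R : Type*} [Monoid R] {n : ℕ} {z : R} (hz : z ^ n = 1) (a b : Fin n) :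
    z ^ ((a + b : Fin n) : ℕ) = z ^ (a : ℕ) * z ^ (b : ℕ) := by
  rw [Fin.val_add, ← pow_eq_pow_mod _ hz, pow_add]

theorem sum_dist_cycleGraph_mul_pow {n : ℕ} {z : ℂ} (hz : z ^ (n + 2) = 1) (u : Fin (n + 2)) :
    ∑ v, ((cycleGraph (n + 2)).dist u v : ℂ) * z ^ (v : ℕ) =
      (∑ d : Fin (n + 2), (cyclicNorm d : ℂ) * z ^ (d : ℕ)) * z ^ (u : ℕ) := by
  rw [← Equiv.sum_comp (Equiv.addLeft u), Finset.sum_mul]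
  refine Finset.sum_congr rfl fun d _ => ?_
  rw [Equiv.coe_addLeft, dist_cycleGraph_add, pow_val_add hz]
  ring

theorem sum_adj_cycleGraph_mul_pow {n : ℕ} {z : ℂ} (hz : z ^ (n + 3) = 1) (u : Fin (n + 3)) :
    ∑ v, (if (cycleGraph (n + 3)).Adj u v then (1 : ℂ) else 0) * z ^ (v : ℕ) =
      (z + z⁻¹) * z ^ (u : ℕ) := by
  have hz0 : z ≠ 0 := by
    rintro rfl
    simp at hz
  have hne : (1 : Fin (n + 3)) ≠ -1 := by
    intro h
    have := congrArg Fin.val h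
    simp [Fin.val_neg] at this
  have hinv : z ^ ((-1 : Fin (n + 3)) : ℕ) = z⁻¹ := by
    have h := pow_val_add hz 1 (-1)
    rw [add_neg_cancel] at h
    simp only [Fin.val_zero, Fin.val_one, pow_zero, pow_one] at h
    exact eq_inv_of_mul_eq_one_right h.symm
  rw [← Equiv.sum_comp (Equiv.addLeft u), add_mul]
  have hadj : ∀ d : Fin (n + 3), (cycleGraph (n + 3)).Adj u (u + d) ↔ d = 1 ∨ d = -1 := by
    intro d
    rw [cycleGraph_adj, add_sub_cancel_left, sub_add_cancel_left, neg_eq_iff_eq_neg, or_comm]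
  simp only [Equiv.coe_addLeft, hadj, pow_val_add hz, ite_mul, one_mul, zero_mul]
  rw [← Finset.sum_filter, Finset.filter_or, Finset.filter_eq', Finset.filter_eq']
  simp only [Finset.mem_univ, if_true]
  rw [← Finset.insert_eq, Finset.sum_pair hne, hinv]
  simp only [Fin.val_one, pow_one]
  ring


theorem exp_two_mul_add_one_sq (x : ℂ) :
    (Complex.exp (2 * x * Complex.I) + 1) ^ 2 =
      4 * Complex.cos x ^ 2 * Complex.exp (2 * x * Complex.I) := by
  have h : Complex.exp (x * Complex.I) * Complex.exp (-x * Complex.I) = 1 := by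
    rw [← Complex.exp_add]
    simp
  have h2 : Complex.exp (2 * x * Complex.I) = Complex.exp (x * Complex.I) ^ 2 := by
    rw [← Complex.exp_nat_mul]
    congr 1
    push_cast
    ring
  rw [Complex.cos, h2]
  generalize Complex.exp (x * Complex.I) = a at *
  generalize Complex.exp (-x * Complex.I) = b at *
  linear_combination (-(2 * a ^ 2) - a * b - 1) * h

theorem exp_two_mul_sub_one_sq (x : ℂ) :
    (Complex.exp (2 * x * Complex.I) - 1) ^ 2 =
      -(4 * Complex.sin x ^ 2 * Complex.exp (2 * x * Complex.I)) := by
  linear_combination exp_two_mul_add_one_sq x +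
    4 * Complex.exp (2 * x * Complex.I) * Complex.sin_sq_add_cos_sq x

/-- The sum `∑ d, |d| z ^ d` over `ℤ / (2m+1)`, for `z = w ^ 2` and `w ^ (2m+1) = 1`. -/
theorem add_one_sq_mul_sum_cyclicNorm {m : ℕ} {w : ℂ} (hw : w ^ (2 * m + 1) = 1) (h1 : w ≠ 1) :
    (w + 1) ^ 2 * ∑ d : Fin (2 * m + 1), (cyclicNorm d : ℂ) * (w ^ 2) ^ (d : ℕ) = -w := by
  have h := one_sub_sq_mul_sum_cyclicNorm m (w ^ 2)
  refine mul_left_cancel₀ (pow_ne_zero 2 (sub_ne_zero.2 h1)) ?_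
  have e1 : (w ^ 2) ^ (m + 1) = w := by
    linear_combination w * hw
  have e2 : (w ^ 2) ^ (m + 2) = w ^ 3 := by
    linear_combination w ^ 3 * hw
  have e3 : (w ^ 2) ^ (2 * m + 2) = w ^ 2 := by
    linear_combination w ^ 2 * (w ^ (2 * m + 1) + 1) * hw
  rw [e1, e2, e3] at h
  linear_combination h

/-- The sum `∑ d, |d| z ^ d` over `ℤ / (2m+1)`, for `z = w ^ 2` and `w ^ (2m+1) = -1`. -/
theorem sub_one_sq_mul_sum_cyclicNorm {m : ℕ} {w : ℂ} (hw : w ^ (2 * m + 1) = -1) (h1 : w ≠ -1) :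
    (w - 1) ^ 2 * ∑ d : Fin (2 * m + 1), (cyclicNorm d : ℂ) * (w ^ 2) ^ (d : ℕ) = w := by
  have h := add_one_sq_mul_sum_cyclicNorm (m := m) (w := -w)
    (by rw [Odd.neg_pow ⟨m, rfl⟩, hw, neg_neg]) (fun h => h1 (by rw [← h, neg_neg]))
  rw [neg_sq] at h
  linear_combination h

/-- For the odd cycle `C_n` with `n = 2m+1`, `m ≥ 1`, the vector
`v^{(j)}` with `k`-th entry `e^{2πijk/n}` is an eigenvector of `sA + tD` with the stated
eigenvalue, where `A` and `D` are the adjacency and distance matrices of `C_n` viewed as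
complex matrices. -/
theorem cycle_odd_eigen (m : ℕ) (hm : 1 ≤ m) (s t : ℝ) (j : Fin (2 * m + 1)) :
    let n : ℕ := 2 * m + 1
    let G : SimpleGraph (Fin n) := SimpleGraph.cycleGraph n
    let A : Matrix (Fin n) (Fin n) ℂ := fun u v => if G.Adj u v then 1 else 0
    let D : Matrix (Fin n) (Fin n) ℂ := fun u v => (G.dist u v : ℂ)
    let v : Fin n → ℂ :=
      fun k => Complex.exp (2 * Real.pi * Complex.I * (j : ℕ) * (k : ℕ) / n)
    let lam : ℂ :=
      if (j : ℕ) = 0 then 2 * (s : ℂ) + (t : ℂ) * ((n : ℂ) ^ 2 - 1) / 4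
      else if Even (j : ℕ) then
        2 * (s : ℂ) * (Real.cos (2 * Real.pi * (j : ℕ) / n) : ℂ) -
          ((t : ℂ) / 4) * ((1 / Real.cos (Real.pi * (j : ℕ) / (2 * n)) : ℝ) : ℂ) ^ 2
      else
        2 * (s : ℂ) * (Real.cos (2 * Real.pi * (j : ℕ) / n) : ℂ) -
          ((t : ℂ) / 4) * ((1 / Real.sin (Real.pi * (j : ℕ) / (2 * n)) : ℝ) : ℂ) ^ 2
    v ≠ 0 ∧ ((s : ℂ) • A + (t : ℂ) • D).mulVec v = lam • v := by
  intro n G A D v lam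
  obtain ⟨k, rfl⟩ : ∃ k, m = k + 1 := ⟨m - 1, by omega⟩
  have hn : (0 : ℝ) < n := by positivity
  have hnC : (n : ℂ) ≠ 0 := Nat.cast_ne_zero.2 (by omega)
  set φ : ℝ := Real.pi * (j : ℕ) / (2 * n) with hφ
  set w : ℂ := Complex.exp (2 * φ * Complex.I) with hw
  have hv : ∀ x, v x = (w ^ 2) ^ (x : ℕ) := by
    intro x
    rw [hw, ← Complex.exp_nat_mul, ← Complex.exp_nat_mul, hφ]
    refine congrArg Complex.exp ?_
    push_cast
    field_simp
  have hwn : w ^ n = (-1) ^ (j : ℕ) := by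
    rw [hw, ← Complex.exp_nat_mul, ← Complex.exp_pi_mul_I, ← Complex.exp_nat_mul, hφ]
    refine congrArg Complex.exp ?_
    push_cast
    field_simp
  have hz : (w ^ 2) ^ n = 1 := by
    rw [← pow_mul, mul_comm, pow_mul, hwn, ← pow_mul, mul_comm, pow_mul]
    simp
  have hw0 : w ≠ 0 := Complex.exp_ne_zero _
  have hcos : w ^ 2 + (w ^ 2)⁻¹ = 2 * (Real.cos (2 * Real.pi * (j : ℕ) / n) : ℂ) := by
    rw [Complex.ofReal_cos, Complex.two_cos, hw, ← Complex.exp_nat_mul, ← Complex.exp_neg, hφ]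
    congr 2 <;> push_cast <;> field_simp
  refine ⟨fun h => pow_ne_zero _ (pow_ne_zero 2 hw0) ((hv 0).symm.trans (congrFun h 0)), ?_⟩
  suffices hlam : lam = s * (w ^ 2 + (w ^ 2)⁻¹) +
      t * ∑ d : Fin n, (cyclicNorm d : ℂ) * (w ^ 2) ^ (d : ℕ) by
    have hA : ∀ u, A.mulVec v u = (w ^ 2 + (w ^ 2)⁻¹) * v u := by
      intro u
      simp only [Matrix.mulVec, dotProduct, hv]
      exact sum_adj_cycleGraph_mul_pow (n := 2 * k) hz u
    have hD : ∀ u, D.mulVec v u =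
        (∑ d : Fin n, (cyclicNorm d : ℂ) * (w ^ 2) ^ (d : ℕ)) * v u := by
      intro u
      simp only [Matrix.mulVec, dotProduct, hv]
      exact sum_dist_cycleGraph_mul_pow (n := 2 * k + 1) hz u
    ext u
    rw [Matrix.add_mulVec, Matrix.smul_mulVec, Matrix.smul_mulVec]
    simp only [Pi.add_apply, Pi.smul_apply, smul_eq_mul, hA, hD, hlam]
    ring
  rw [hcos]
  by_cases hj : (j : ℕ) = 0
  · have hw1 : w = 1 := by simp [hw, hφ, hj]
    simp only [lam, hw1, hj, if_true, one_pow, mul_one, n]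
    rw [sum_cyclicNorm]
    simp
    ring
  have hj0 : (0 : ℝ) < (j : ℕ) := Nat.cast_pos.2 (Nat.pos_of_ne_zero hj)
  have hjn : ((j : ℕ) : ℝ) < n := Nat.cast_lt.2 j.isLt
  have hφ0 : 0 < φ := by positivity
  have hφ1 : φ < Real.pi / 2 := by
    rw [hφ, div_lt_div_iff₀ (by positivity) (by positivity)]
    nlinarith [Real.pi_pos]
  have hc : (Real.cos φ : ℂ) ≠ 0 :=
    Complex.ofReal_ne_zero.2 (Real.cos_pos_of_mem_Ioo ⟨by linarith, hφ1⟩).ne'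
  have hs : (Real.sin φ : ℂ) ≠ 0 :=
    Complex.ofReal_ne_zero.2 (Real.sin_pos_of_pos_of_lt_pi hφ0 (by linarith)).ne'
  have hadd := exp_two_mul_add_one_sq φ
  have hsub := exp_two_mul_sub_one_sq φ
  rw [← hw, ← Complex.ofReal_cos] at hadd
  rw [← hw, ← Complex.ofReal_sin] at hsub
  by_cases he : Even (j : ℕ)
  · have hw1 : w ≠ 1 := by
      intro h
      rw [h] at hsub
      simp at hsub
      exact hs ((Complex.ofReal_sin φ).trans hsub)
    have hP := add_one_sq_mul_sum_cyclicNorm (hwn.trans he.neg_one_pow) hw1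
    simp only [lam, hj, he, if_true, if_false]
    rw [hadd, mul_right_comm] at hP
    have hP' := mul_right_cancel₀ hw0 (hP.trans (neg_one_mul w).symm)
    rw [← hφ, Complex.ofReal_div, Complex.ofReal_one]
    field_simp
    linear_combination -t * hP'
  · have hw1 : w ≠ -1 := by
      intro h
      rw [h] at hadd
      simp at hadd
      exact hc ((Complex.ofReal_cos φ).trans hadd)
    have hP := sub_one_sq_mul_sum_cyclicNorm
      (hwn.trans (Nat.not_even_iff_odd.1 he).neg_one_pow) hw1
    simp only [lam, hj, he, if_false]
    rw [hsub, neg_mul, mul_right_comm, neg_eq_iff_eq_neg] at hP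
    have hP' := mul_right_cancel₀ hw0 (hP.trans (neg_one_mul w).symm)
    rw [← hφ, Complex.ofReal_div, Complex.ofReal_one]
    field_simp
    linear_combination -t * hP'
end

section
/- Let n ≥ 1 and k ≥ 1, let B and C be k×k matrices over a field F, and let M be the nk×nk matrix consisting of n×n blocks of size k×k whose n diagonal blocks all equal B and whose off-diagonal blocks all equal C (i.e., M((a,s),(b,t)) = B(s,t) if a = b and C(s,t) if a ≠ b). Then the characteristic polynomial of M equals charpoly(B + (n−1)·C) · charpoly(B − C)^{n−1}. -/
open Polynomial

namespace Matrix

open scoped Kronecker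

variable {R ι κ : Type*} [CommRing R] [Fintype ι] [DecidableEq ι] [Fintype κ] [DecidableEq κ]

theorem det_one_kronecker_add_ones_kronecker_mul_of_isUnit (D C : Matrix κ κ R)
    (hD : IsUnit D.det) :
    ((1 : Matrix ι ι R) ⊗ₖ D + (of fun _ _ => 1 : Matrix ι ι R) ⊗ₖ C).det * D.det =
      (D + Fintype.card ι • C).det * D.det ^ Fintype.card ι := by
  let U : Matrix (ι × κ) κ R := of fun p j => C p.2 j
  let V : Matrix κ (ι × κ) R := of fun i p => (1 : Matrix κ κ R) i p.2
  have hUV : (of fun _ _ => 1 : Matrix ι ι R) ⊗ₖ C = U * V := by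
    ext p q
    simp [U, V, mul_apply, one_apply]
  have hdet : ((1 : Matrix ι ι R) ⊗ₖ D).det = D.det ^ Fintype.card ι := by
    simp [det_kronecker]
  have hV : V * ((1 : Matrix ι ι R) ⊗ₖ D)⁻¹ * U = Fintype.card ι • (D⁻¹ * C) := by
    rw [inv_kronecker, inv_one]
    ext i j
    simp [U, V, mul_apply, Fintype.sum_prod_type, one_apply]
  have hA : IsUnit ((1 : Matrix ι ι R) ⊗ₖ D).det := hdet ▸ hD.pow _
  rw [hUV, det_add_mul _ _ hA, hdet, hV, mul_assoc, mul_comm (det _) D.det, ← det_mul,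
    mul_comm, mul_add, mul_one, mul_smul_comm, mul_nonsing_inv_cancel_left _ _ hD]

theorem det_one_kronecker_add_ones_kronecker_mul [IsDomain R] (D C : Matrix κ κ R)
    (hD : D.det ≠ 0) :
    ((1 : Matrix ι ι R) ⊗ₖ D + (of fun _ _ => 1 : Matrix ι ι R) ⊗ₖ C).det * D.det =
      (D + Fintype.card ι • C).det * D.det ^ Fintype.card ι := by
  let f := algebraMap R (FractionRing R)
  have hf : Function.Injective f := IsFractionRing.injective R (FractionRing R)
  apply hf
  have hu : IsUnit (f.mapMatrix D).det := by
    rw [← RingHom.map_det]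
    exact isUnit_iff_ne_zero.mpr ((map_ne_zero_iff f hf).mpr hD)
  have h := det_one_kronecker_add_ones_kronecker_mul_of_isUnit (ι := ι)
    (f.mapMatrix D) (f.mapMatrix C) hu
  rw [map_mul, map_mul, map_pow, RingHom.map_det, RingHom.map_det, RingHom.map_det,
    map_add f.mapMatrix D, map_nsmul]
  convert h using 3
  ext p q
  simp [one_apply, apply_ite f]

theorem charmatrix_block_constant (B C : Matrix κ κ R) :
    (of fun p q : ι × κ => if p.1 = q.1 then B p.2 q.2 else C p.2 q.2).charmatrix =
      (1 : Matrix ι ι R[X]) ⊗ₖ (B - C).charmatrix +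
        (of fun _ _ => 1 : Matrix ι ι R[X]) ⊗ₖ (-C.map Polynomial.C) := by
  ext1 ⟨a, s⟩ ⟨b, t⟩
  rcases eq_or_ne a b with rfl | hab
  · simp [charmatrix_apply, diagonal_apply]
    ring
  · simp [charmatrix_apply, hab]

theorem charmatrix_add_nsmul (B C : Matrix κ κ R) (m : ℕ) :
    (B + m • C).charmatrix = (B - C).charmatrix + (m + 1) • -C.map Polynomial.C := by
  ext1 s t
  simp only [charmatrix_apply, add_apply, sub_apply, smul_apply, neg_apply, map_apply, map_add,
    map_sub, map_nsmul, succ_nsmul, smul_neg]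
  ring

end Matrix

/-- Let `M` be the `nk×nk` block matrix over a field `F` whose `n`
diagonal `k×k` blocks all equal `B` and whose off-diagonal blocks all equal `C`.  Then
`charpoly(M) = charpoly(B + (n−1)·C) · charpoly(B − C)^{n−1}`. -/
theorem charpoly_block_constant (F : Type*) [Field F] (n k : ℕ) (hn : 1 ≤ n)
    (hk : 1 ≤ k) (B C : Matrix (Fin k) (Fin k) F) :
    let M : Matrix (Fin n × Fin k) (Fin n × Fin k) F :=
      fun p q => if p.1 = q.1 then B p.2 q.2 else C p.2 q.2
    M.charpoly = (B + (n - 1) • C).charpoly * (B - C).charpoly ^ (n - 1) := by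
  intro M
  obtain ⟨m, rfl⟩ : ∃ m, n = m + 1 := ⟨n - 1, by omega⟩
  have hD : (B - C).charmatrix.det ≠ 0 := (B - C).charpoly_monic.ne_zero
  have h := Matrix.det_one_kronecker_add_ones_kronecker_mul (ι := Fin (m + 1))
    (B - C).charmatrix (-C.map Polynomial.C) hD
  rw [← Matrix.charmatrix_block_constant, Fintype.card_fin, ← Matrix.charmatrix_add_nsmul,
    pow_succ, ← mul_assoc] at h
  exact mul_right_cancel₀ hD h
end
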